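/- Let f : ℝ → ℝ be a nonnegative function whose support S is an interval, and suppose f satisfies the ratio condition f(a+c)*f(b) ≥ f(b+c)*f(a) for all a ≤ b and c ≥ 0 with all four values positive. Then for any x < y < z in S such that (y − x)/(z − y) is rational, one has log f(y) ≥ ((z−y)/(z−x)) * log f(x) + ((y−x)/(z−x)) * log f(z). -/

import Mathlib

/-- The ratio condition implies the concavity inequality for `log f` at
rationally related points of the support. -/
theorem ratio_condition_log_concave_rational
    (f : ℝ → ℝ) (hf : ∀ y, 0 ≤ f y)
    (hord : Set.OrdConnected {y | 0 < f y})
    (hratio : ∀ a b c : ℝ, a ≤ b → 0 ≤ c → 0 < f a → 0 < f b →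
      0 < f (a + c) → 0 < f (b + c) → f (b + c) * f a ≤ f (a + c) * f b)
    (x y z : ℝ) (hxy : x < y) (hyz : y < z)
    (hx : 0 < f x) (hy : 0 < f y) (hz : 0 < f z)
    (hrat : ∃ q : ℚ, (y - x) / (z - y) = (q : ℝ)) :
    (z - y) / (z - x) * Real.log (f x) + (y - x) / (z - x) * Real.log (f z) ≤
      Real.log (f y) := by
  obtain ⟨q, hq⟩ := hrat
  have hyx0 : 0 < y - x := sub_pos.2 hxy
  have hzy0 : 0 < z - y := sub_pos.2 hyz
  have hq0 : 0 < q := by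
    have : (0 : ℝ) < (q : ℝ) := hq ▸ div_pos hyx0 hzy0
    exact_mod_cast this
  obtain ⟨m, hm⟩ : ∃ m : ℕ, q.num = (m : ℤ) :=
    ⟨q.num.toNat, (Int.toNat_of_nonneg (Rat.num_pos.2 hq0).le).symm⟩
  have hm0 : 0 < m := by
    have := Rat.num_pos.2 hq0
    omega
  obtain ⟨n, hn⟩ : ∃ n : ℕ, q.den = n := ⟨_, rfl⟩
  have hn0 : 0 < n := hn ▸ q.den_pos
  have hqr : (q : ℝ) = (m : ℝ) / n := by
    rw [Rat.cast_def, hm, hn]; simp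
  have hnR : (0 : ℝ) < n := by exact_mod_cast hn0
  have hmR : (0 : ℝ) < m := by exact_mod_cast hm0
  rw [hqr, div_eq_div_iff hzy0.ne' hnR.ne'] at hq
  obtain ⟨c, hc⟩ : ∃ c : ℝ, c = (z - y) / n := ⟨_, rfl⟩
  have hc0 : 0 < c := hc ▸ div_pos hzy0 hnR
  have hzc : z - y = n * c := by rw [hc]; field_simp
  have hyc : y - x = m * c := by
    rw [hzc] at hq
    have : (n : ℝ) * (y - x) = n * (m * c) := by linarith
    exact mul_left_cancel₀ hnR.ne' this
  have hpos : ∀ k : ℕ, k ≤ m + n → 0 < f (x + k * c) := by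
    intro k hk
    have hk' : (k : ℝ) ≤ m + n := by exact_mod_cast hk
    have h1 : (k : ℝ) * c ≤ (m + n) * c := mul_le_mul_of_nonneg_right hk' hc0.le
    have h2 : 0 ≤ (k : ℝ) * c := by positivity
    exact hord.out hx hz ⟨by linarith, by linarith⟩
  obtain ⟨g, hg⟩ : ∃ g : ℕ → ℝ, ∀ k, g k = Real.log (f (x + k * c)) := ⟨_, fun _ => rfl⟩
  have hd : ∀ i j : ℕ, i ≤ j → j + 1 ≤ m + n → g (j + 1) + g i ≤ g (i + 1) + g j := by
    intro i j hij hj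
    have hij' : (i : ℝ) ≤ j := by exact_mod_cast hij
    have pi := hpos i (by omega)
    have pj := hpos j (by omega)
    have pi1 := hpos (i + 1) (by omega)
    have pj1 := hpos (j + 1) hj
    have e : ∀ k : ℕ, x + ((k + 1 : ℕ) : ℝ) * c = x + k * c + c := by
      intro k; push_cast; ring
    rw [hg, hg, hg, hg, ← Real.log_mul pj1.ne' pi.ne', ← Real.log_mul pi1.ne' pj.ne']
    apply Real.log_le_log (mul_pos pj1 pi)
    rw [e] at pi1 pj1 ⊢
    rw [e]
    exact hratio _ _ c (by nlinarith) hc0.le pi pj pi1 pj1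
  obtain ⟨p, rfl⟩ : ∃ p, m = p + 1 := ⟨m - 1, by omega⟩
  have hA : ∀ k : ℕ, k ≤ p + 1 → g 0 + k * (g (p + 1) - g p) ≤ g k := by
    intro k
    induction k with
    | zero => intro _; simp
    | succ k ih =>
      intro hk
      have := ih (by omega)
      have := hd k p (by omega) (by omega)
      push_cast
      linarith
  have hB : ∀ k : ℕ, k ≤ n → g (p + 1 + k) ≤ g (p + 1) + k * (g (p + 1) - g p) := by
    intro k
    induction k with
    | zero => intro _; simp
    | succ k ih =>
      intro hk
      have := ih (by omega)
      have := hd p (p + 1 + k) (by omega) (by omega)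
      rw [← add_assoc]
      push_cast
      linarith
  have h1 := mul_le_mul_of_nonneg_left (hA (p + 1) le_rfl) hnR.le
  have h2 := mul_le_mul_of_nonneg_left (hB n le_rfl) hmR.le
  have g0 : g 0 = Real.log (f x) := by rw [hg]; simp
  have g1 : g (p + 1) = Real.log (f y) := by
    rw [hg, ← hyc]; congr 2; ring
  have g2 : g (p + 1 + n) = Real.log (f z) := by
    rw [hg]; congr 2; rw [Nat.cast_add, add_mul, ← hyc, ← hzc]; ring
  have hzx : z - x = (((p + 1 : ℕ) : ℝ) + n) * c := by linarith
  rw [← g0, ← g1, ← g2, hzx, hzc, hyc, mul_div_mul_right _ _ hc0.ne',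
    mul_div_mul_right _ _ hc0.ne', div_mul_eq_mul_div, div_mul_eq_mul_div, ← add_div,
    div_le_iff₀ (by positivity)]
  linarith
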